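/- Let F be a skew hyperfield satisfying strong Pathetic Cancellation. Then 1 ⊞ (−1) ⊞ 1 ⊞ (−1) = 1 ⊞ (−1). -/

import Mathlib

open Set

namespace PaperSHF

/-- A skew hyperfield: `F ∖ {0}` is a group under `mul`, `0` is multiplicatively
absorbing, and `add` is a commutative associative hyperaddition with neutral
element `0`, hyperinverses, reversibility, and two-sided distributivity. -/
structure SkewHyperfield (F : Type*) where
  zero : F
  one : F
  mul : F → F → F
  inv : F → F
  neg : F → F
  add : F → F → Set F
  zero_ne_one : zero ≠ one
  mul_assoc : ∀ a b c, mul (mul a b) c = mul a (mul b c)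
  one_mul : ∀ a, mul one a = a
  mul_one : ∀ a, mul a one = a
  mul_ne_zero : ∀ a b, a ≠ zero → b ≠ zero → mul a b ≠ zero
  inv_ne_zero : ∀ a, a ≠ zero → inv a ≠ zero
  mul_inv_cancel : ∀ a, a ≠ zero → mul a (inv a) = one
  inv_mul_cancel : ∀ a, a ≠ zero → mul (inv a) a = one
  zero_mul : ∀ a, mul zero a = zero
  mul_zero : ∀ a, mul a zero = zero
  add_nonempty : ∀ a b, (add a b).Nonempty
  add_comm : ∀ a b, add a b = add b a
  add_assoc : ∀ a b c, (⋃ t ∈ add b c, add a t) = (⋃ s ∈ add a b, add s c)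
  zero_add : ∀ a, add zero a = {a}
  add_neg_self : ∀ a, zero ∈ add a (neg a)
  neg_unique : ∀ a b, zero ∈ add a b → b = neg a
  reversibility : ∀ x y z, x ∈ add y z ↔ z ∈ add x (neg y)
  left_distrib : ∀ a x y, add (mul a x) (mul a y) = (fun t => mul a t) '' (add x y)
  right_distrib : ∀ a x y, add (mul x a) (mul y a) = (fun t => mul t a) '' (add x y)

/-- The hyperaddition extended to subsets: `A ⊞ B = ⋃_{a ∈ A, b ∈ B} a ⊞ b`. -/
def SkewHyperfield.sadd {F : Type*} (H : SkewHyperfield F) (A B : Set F) : Set F :=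
  ⋃ a ∈ A, ⋃ b ∈ B, H.add a b

/-- Strong Pathetic Cancellation. -/
def StrongPatheticCancellation {F : Type*} (H : SkewHyperfield F) : Prop :=
  ∀ a b x y : F, a ≠ H.zero → b ≠ H.zero → x ≠ H.zero → y ≠ H.zero →
    x ∈ H.add H.one a → y ∈ H.add (H.neg H.one) b →
    H.add x y ∩ H.add a b ⊆ H.add (H.mul x b) (H.neg (H.mul a y))

/-- Pathetic Cancellation. -/
def PatheticCancellation {F : Type*} (H : SkewHyperfield F) : Prop :=
  ∀ a b x y z : F, a ≠ H.zero → b ≠ H.zero → x ≠ H.zero → y ≠ H.zero → z ≠ H.zero →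
    x ∈ H.add H.one a → H.mul a x = H.mul x a →
    y ∈ H.add (H.neg H.one) b → H.mul b y = H.mul y b →
    z ∈ H.add a b →
    H.mul (H.mul (H.inv a) z) (H.inv b) = H.mul (H.mul (H.inv b) z) (H.inv a) →
    z ∈ H.add x y →
    H.mul (H.mul (H.inv x) z) (H.inv y) = H.mul (H.mul (H.inv y) z) (H.inv x) →
    z ∈ H.add (H.mul x b) (H.neg (H.mul a y))



namespace SkewHyperfield

variable {F : Type*} (H : SkewHyperfield F)

theorem mul_mem_add_left (a : F) {x y t : F} (h : t ∈ H.add x y) :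
    H.mul a t ∈ H.add (H.mul a x) (H.mul a y) := by
  rw [H.left_distrib]
  exact ⟨t, h, rfl⟩

theorem mul_mem_add_right (a : F) {x y t : F} (h : t ∈ H.add x y) :
    H.mul t a ∈ H.add (H.mul x a) (H.mul y a) := by
  rw [H.right_distrib]
  exact ⟨t, h, rfl⟩

theorem mul_neg_one (a : F) : H.mul a (H.neg H.one) = H.neg a := by
  apply H.neg_unique
  simpa only [H.mul_zero, H.mul_one] using H.mul_mem_add_left a (H.add_neg_self H.one)

theorem neg_one_mul (a : F) : H.mul (H.neg H.one) a = H.neg a := by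
  apply H.neg_unique
  simpa only [H.zero_mul, H.one_mul] using H.mul_mem_add_right a (H.add_neg_self H.one)

theorem neg_neg (a : F) : H.neg (H.neg a) = a := by
  refine (H.neg_unique _ _ ?_).symm
  rw [H.add_comm]
  exact H.add_neg_self a

theorem neg_mul (a b : F) : H.mul (H.neg a) b = H.neg (H.mul a b) := by
  rw [← H.neg_one_mul a, H.mul_assoc, H.neg_one_mul]

theorem mul_neg (a b : F) : H.mul a (H.neg b) = H.neg (H.mul a b) := by
  rw [← H.mul_neg_one b, ← H.mul_assoc, H.mul_neg_one]

theorem neg_ne_zero {a : F} (ha : a ≠ H.zero) : H.neg a ≠ H.zero := by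
  intro h
  apply ha
  rw [← H.neg_neg a, h, ← H.mul_neg_one, H.zero_mul]

theorem neg_mem_one_add_neg_one {d : F} (h : d ∈ H.add H.one (H.neg H.one)) :
    H.neg d ∈ H.add H.one (H.neg H.one) := by
  have := H.mul_mem_add_left (H.neg H.one) h
  rwa [H.mul_one, H.neg_one_mul, H.neg_one_mul, H.neg_neg, H.add_comm] at this

/-- `1 ⊞ (-1)` is invariant under conjugation. -/
theorem conj_mem_one_add_neg_one {d t : F} (hd : d ≠ H.zero)
    (h : t ∈ H.add H.one (H.neg H.one)) :
    H.mul (H.inv d) (H.mul t d) ∈ H.add H.one (H.neg H.one) := by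
  have := H.mul_mem_add_left (H.inv d) (H.mul_mem_add_right d h)
  rwa [H.one_mul, H.neg_one_mul, H.mul_neg, H.inv_mul_cancel d hd] at this

theorem inv_mem_one_add_inv {d : F} (hd : d ≠ H.zero) (h : d ∈ H.add H.one (H.neg H.one)) :
    H.inv d ∈ H.add H.one (H.inv d) := by
  have := H.mul_mem_add_left (H.inv d) ((H.reversibility _ _ _).2 h)
  rwa [H.mul_one, H.inv_mul_cancel d hd, H.add_comm] at this

theorem mem_sadd_sadd_singleton {A : Set F} {b c z : F} :
    z ∈ H.sadd (H.sadd A {b}) {c} ↔ ∃ a ∈ A, ∃ t ∈ H.add b c, z ∈ H.add a t := by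
  have assoc (a : F) := Set.ext_iff.1 (H.add_assoc a b c) z
  simp only [mem_iUnion, exists_prop] at assoc
  simp only [sadd, mem_iUnion, mem_singleton_iff, exists_prop, exists_eq_left, assoc]
  grind

end SkewHyperfield

/-- Under strong Pathetic Cancellation, `1 ⊞ (-1)` is closed under hyperaddition. -/
theorem StrongPatheticCancellation.add_subset_one_add_neg_one {F : Type*} {H : SkewHyperfield F}
    (hspc : StrongPatheticCancellation H) {d f : F}
    (hd : d ∈ H.add H.one (H.neg H.one)) (hf : f ∈ H.add H.one (H.neg H.one)) :
    H.add d f ⊆ H.add H.one (H.neg H.one) := by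
  intro z hz
  by_cases hd0 : d = H.zero
  · rw [hd0, H.zero_add, mem_singleton_iff] at hz
    rwa [hz]
  by_cases hf0 : f = H.zero
  · rw [hf0, H.add_comm, H.zero_add, mem_singleton_iff] at hz
    rwa [hz]
  -- With `a = (-f)⁻¹` and `b = -d⁻¹`, one has `d ⊞ f = (-f) (a ⊞ b) d`.
  have he0 := H.neg_ne_zero hf0
  have hx := H.inv_mem_one_add_inv he0 (H.neg_mem_one_add_neg_one hf)
  have hy := H.mul_mem_add_left (H.neg H.one) (H.inv_mem_one_add_inv hd0 hd)
  rw [H.mul_one, H.neg_one_mul] at hy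
  have ha := H.inv_ne_zero _ he0
  have hb := H.neg_ne_zero (H.inv_ne_zero _ hd0)
  have hdf : H.add d f =
      (fun t => H.mul t d) '' ((fun t => H.mul (H.neg f) t) ''
        H.add (H.inv (H.neg f)) (H.neg (H.inv d))) := by
    rw [← H.left_distrib, ← H.right_distrib, H.mul_inv_cancel _ he0, H.one_mul, H.mul_neg,
      H.neg_mul f, H.neg_neg, H.mul_assoc, H.inv_mul_cancel d hd0, H.mul_one]
  rw [hdf] at hz
  obtain ⟨_, ⟨w, hw, rfl⟩, rfl⟩ := hz
  have hw' := hspc _ _ _ _ ha hb ha hb hx hy ⟨hw, hw⟩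
  rw [← H.mul_neg_one (H.mul _ _)] at hw'
  nth_rw 1 [← H.mul_one (H.mul _ _)] at hw'
  rw [H.left_distrib] at hw'
  obtain ⟨t, ht, rfl⟩ := hw'
  have key := H.neg_mem_one_add_neg_one (H.conj_mem_one_add_neg_one hd0 ht)
  convert key using 1
  simp only [← H.mul_assoc, H.mul_inv_cancel _ he0, H.one_mul, H.neg_mul (H.inv d),
    H.neg_mul (H.mul _ _)]

/-- if `F` satisfies strong Pathetic Cancellation then
`1 ⊞ (-1) ⊞ 1 ⊞ (-1) = 1 ⊞ (-1)`. -/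
theorem four_fold_sum {F : Type*} (H : SkewHyperfield F)
    (hspc : StrongPatheticCancellation H) :
    H.sadd (H.sadd (H.add H.one (H.neg H.one)) {H.one}) {H.neg H.one}
      = H.add H.one (H.neg H.one) := by
  ext z
  rw [H.mem_sadd_sadd_singleton]
  constructor
  · rintro ⟨d, hd, f, hf, hz⟩
    exact hspc.add_subset_one_add_neg_one hd hf hz
  · intro hz
    refine ⟨z, hz, H.zero, H.add_neg_self _, ?_⟩
    rw [H.add_comm, H.zero_add]
    exact mem_singleton z

end PaperSHF
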